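/- Define h : ℝ → ℝ by h(x) = tanh(x) for x ≤ 0, h(x) = x for 0 ≤ x ≤ 1, and h(x) = tanh(x − 1) + 1 for x ≥ 1. Then h is a C¹ nowhere coexpanding function and its fixed point set is Fix(h) = {x ∈ ℝ : h(x) = x} = [0, 1]. -/

import Mathlib

open Set

/-- A C¹ function `f : ℝ → ℝ` is nowhere coexpanding if for every connected component of
`ℝ \ Crit f` and all distinct `x, y` in that component, `χ_f(x,y) ≤ 1`. -/
def NowhereCoexpanding (f : ℝ → ℝ) : Prop :=
  ∀ x y : ℝ, x ≠ y →
    y ∈ connectedComponentIn {z : ℝ | deriv f z ≠ 0} x →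
    deriv f x * deriv f y * ((x - y) / (f x - f y)) ^ 2 ≤ 1

lemma glue_hasDerivAt (f g f' g' : ℝ → ℝ) (a : ℝ) (hf : ∀ x, HasDerivAt f (f' x) x)
    (hg : ∀ x, HasDerivAt g (g' x) x) (h0 : f a = g a) (h1 : f' a = g' a) (x : ℝ) :
    HasDerivAt (fun x => if x ≤ a then f x else g x) (if x ≤ a then f' x else g' x) x := by
  rcases lt_trichotomy x a with h | h | h
  · rw [if_pos h.le]
    refine (hf x).congr_of_eventuallyEq ?_
    filter_upwards [Iio_mem_nhds h] with z hz
    rw [if_pos (le_of_lt hz)]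
  · subst h
    rw [if_pos le_rfl]
    have hl : HasDerivWithinAt (fun z => if z ≤ x then f z else g z) (f' x) (Iic x) x := by
      refine (hf x).hasDerivWithinAt.congr (fun z hz => if_pos hz) (if_pos le_rfl)
    have hr : HasDerivWithinAt (fun z => if z ≤ x then f z else g z) (f' x) (Ici x) x := by
      rw [h1]
      refine (hg x).hasDerivWithinAt.congr (fun z hz => ?_) (by rw [if_pos le_rfl, h0])
      rcases eq_or_lt_of_le (show x ≤ z from hz) with e | e
      · rw [← e, if_pos le_rfl, h0]
      · rw [if_neg (not_le.2 e)]
    have := hl.union hr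
    rwa [Iic_union_Ici, hasDerivWithinAt_univ] at this
  · rw [if_neg (not_le.2 h)]
    refine (hg x).congr_of_eventuallyEq ?_
    filter_upwards [Ioi_mem_nhds h] with z hz
    rw [if_neg (not_le.2 hz)]

lemma tanh_hasDerivAt (x : ℝ) : HasDerivAt Real.tanh (1 / Real.cosh x ^ 2) x := by
  have h := (Real.hasDerivAt_sinh x).div (Real.hasDerivAt_cosh x) (Real.cosh_pos x).ne'
  have e : Real.tanh = (Real.sinh / Real.cosh) := by
    funext z; simp [Real.tanh_eq_sinh_div_cosh]
  rw [e]
  have e2 : Real.cosh x * Real.cosh x - Real.sinh x * Real.sinh x = 1 := by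
    have := Real.cosh_sq x
    linarith
  rwa [e2] at h

lemma tanh_lt_self_pos {x : ℝ} (hx : 0 < x) : Real.tanh x < x := by
  obtain ⟨c, hc, h⟩ := exists_hasDerivAt_eq_slope Real.tanh _ hx
    (fun z _ => (tanh_hasDerivAt z).continuousAt.continuousWithinAt)
    (fun z _ => tanh_hasDerivAt z)
  have h1 : 1 / Real.cosh c ^ 2 < 1 := by
    have := Real.one_lt_cosh.2 hc.1.ne'
    rw [div_lt_one (by positivity)]
    nlinarith
  rw [h, Real.tanh_zero, sub_zero, sub_zero, div_lt_one hx] at h1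
  exact h1

noncomputable def hh (x : ℝ) : ℝ := if x ≤ 0 then Real.tanh x
        else if x ≤ 1 then x else Real.tanh (x - 1) + 1

noncomputable def uu (x : ℝ) : ℝ := if x ≤ 0 then Real.cosh x
        else if x ≤ 1 then 1 else Real.cosh (x - 1)

lemma uu_pos (x : ℝ) : 0 < uu x := by
  unfold uu; split_ifs <;> first | exact Real.cosh_pos _ | norm_num

lemma uu_cont : Continuous uu := by
  unfold uu
  refine Continuous.if_le Real.continuous_cosh (Continuous.if_le continuous_const (by fun_prop) continuous_id continuous_const ?_)
    continuous_id continuous_const ?_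
  · intro x hx; subst hx; simp
  · intro x hx; subst hx; simp

lemma hh_deriv (x : ℝ) : HasDerivAt hh (1 / uu x ^ 2) x := by
  have h2 := fun x => glue_hasDerivAt (fun x => x) (fun x => Real.tanh (x - 1) + 1) (fun _ => 1)
    (fun x => 1 / Real.cosh (x - 1) ^ 2) 1 (fun x => hasDerivAt_id x)
    (fun x => by
      have := (tanh_hasDerivAt (x - 1)).comp x ((hasDerivAt_id x).sub_const 1)
      simpa using this.add_const 1) (by simp) (by simp) x
  have h3 := glue_hasDerivAt _ _ _ _ 0 tanh_hasDerivAt h2 (by simp) (by simp) x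
  have e : 1 / uu x ^ 2 = if x ≤ 0 then 1 / Real.cosh x ^ 2 else
      if x ≤ 1 then 1 else 1 / Real.cosh (x - 1) ^ 2 := by
    unfold uu; split_ifs <;> simp
  rw [e]
  exact h3

lemma sub_id (c s d r : ℝ) (hc : 0 < c) (hd : 0 < d) : (s / c - r / d) * d * c = s * d - c * r := by
  field_simp

lemma key {x y : ℝ} (h : x < y) : y - x ≤ (hh y - hh x) * uu x * uu y := by
  have T : ∀ x y : ℝ, x < y → y - x ≤ (Real.tanh y - Real.tanh x) * Real.cosh x * Real.cosh y := by
    intro x y h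
    rw [Real.tanh_eq_sinh_div_cosh, Real.tanh_eq_sinh_div_cosh,
      sub_id _ _ _ _ (Real.cosh_pos _) (Real.cosh_pos _), ← Real.sinh_sub]
    exact Real.self_le_sinh_iff.2 (by linarith)
  have S : ∀ x, Real.tanh x * Real.cosh x = Real.sinh x := fun x => by
    rw [Real.tanh_eq_sinh_div_cosh, div_mul_cancel₀ _ (Real.cosh_pos x).ne']
  have cx := Real.one_le_cosh x
  have cy := Real.one_le_cosh (y - 1)
  unfold hh uu
  split_ifs with h1 h2 h3 h4 h5 h6 h7 h8
  all_goals first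
    | exact T x y h
    | linarith
    | skip
  · have := S x
    have := Real.sinh_le_self_iff.2 (show x ≤ 0 by assumption)
    nlinarith
  · have a := S x
    have b := S (y - 1)
    have c := Real.self_le_sinh_iff.2 (show 0 ≤ (y - 1) - x by linarith)
    rw [Real.sinh_sub] at c
    have : (Real.tanh (y - 1) + 1 - Real.tanh x) * Real.cosh x * Real.cosh (y - 1) =
      Real.sinh (y-1) * Real.cosh x - Real.cosh (y-1) * Real.sinh x + Real.cosh x * Real.cosh (y-1) := by
      rw [← a, ← b]; ring
    rw [this]
    nlinarith
  · have b := S (y - 1)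
    have c := Real.self_le_sinh_iff.2 (show 0 ≤ (y - 1) by linarith)
    nlinarith
  · have := T (x - 1) (y - 1) (by linarith)
    simpa using this

theorem fix_Icc_example :
    ContDiff ℝ 1
      (fun x : ℝ => if x ≤ 0 then Real.tanh x
        else if x ≤ 1 then x else Real.tanh (x - 1) + 1) ∧
    NowhereCoexpanding
      (fun x : ℝ => if x ≤ 0 then Real.tanh x
        else if x ≤ 1 then x else Real.tanh (x - 1) + 1) ∧
    {x : ℝ | (if x ≤ 0 then Real.tanh x
        else if x ≤ 1 then x else Real.tanh (x - 1) + 1) = x} = Icc (0 : ℝ) 1 := by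
  have hd : deriv hh = fun x => 1 / uu x ^ 2 := funext fun x => (hh_deriv x).deriv
  refine ⟨?_, ?_, ?_⟩
  · change ContDiff ℝ 1 hh
    rw [contDiff_one_iff_deriv, hd]
    exact ⟨fun x => (hh_deriv x).differentiableAt,
      continuous_const.div (uu_cont.pow 2) (fun x => (pow_pos (uu_pos x) 2).ne')⟩
  · change NowhereCoexpanding hh
    have main : ∀ x y, x < y → deriv hh x * deriv hh y * ((x - y) / (hh x - hh y)) ^ 2 ≤ 1 := by
      intro x y h
      have k := key h
      have px := uu_pos x
      have py := uu_pos y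
      have pos : 0 < (hh y - hh x) * uu x * uu y := by linarith
      have e : deriv hh x * deriv hh y * ((x - y) / (hh x - hh y)) ^ 2 =
          ((y - x) / ((hh y - hh x) * uu x * uu y)) ^ 2 := by
        rw [hd, ← neg_sub y x, ← neg_sub (hh y) (hh x), neg_div_neg_eq]
        simp only [div_pow, mul_pow, div_mul_div_comm]
        ring
      rw [e]
      exact pow_le_one₀ (div_nonneg (by linarith) pos.le) ((div_le_one pos).2 k)
    intro x y hne _
    rcases lt_or_gt_of_ne hne with h | h
    · exact main x y h
    · have := main y x h
      rw [← neg_sub x y, ← neg_sub (hh x) (hh y), neg_div_neg_eq, mul_comm (deriv hh y)] at this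
      exact this
  · ext x
    simp only [mem_ofPred_eq, mem_Icc]
    split_ifs with h1 h2
    · constructor
      · intro h
        rcases eq_or_lt_of_le h1 with e | e
        · simp [e]
        · have := tanh_lt_self_pos (neg_pos.2 e)
          rw [Real.tanh_neg] at this
          linarith
      · intro h
        have : x = 0 := le_antisymm h1 h.1
        simp [this]
    · simp [h2, (not_le.1 h1).le]
    · constructor
      · intro h
        have := tanh_lt_self_pos (show 0 < x - 1 by linarith [not_le.1 h2])
        linarith
      · intro h; exact absurd h.2 h2
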